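/- arXiv:1406.1538 — 2 statements merged into one kernel-verified Lean document; each statement's English description precedes it below -/
import Mathlib

section
/- Let 1/2 < H < 1 and T > 0. Then the iterated integral over the simplex {0 ≤ u₂ ≤ u₁ ≤ v₁ ≤ v₂ ≤ T} of 4(H(2H−1))² (v₁−u₁)^{2H−2}(v₂−u₂)^{2H−2} [ (T−u₁)(T−v₂) + 2(T−v₁)(T−v₂) ] dv₂ du₂ dv₁ du₁ equals ((2H−1)(H+2) / ((2H+1)(4H+2)(4H−1))) · T^{4H+2}. -/
open MeasureTheory

theorem intervalIntegrable_rpow_mul_poly {r : ℝ} (hr : -1 < r) (a c c₀ c₁ c₂ : ℝ) :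
    IntervalIntegrable (fun s : ℝ => s ^ r * (c₀ + c₁ * s + c₂ * s ^ 2)) volume a c :=
  (intervalIntegral.intervalIntegrable_rpow' hr).mul_continuousOn (by fun_prop)

theorem integral_rpow_mul_poly {r a c : ℝ} (hr : -1 < r) (ha : 0 ≤ a) (hac : a ≤ c)
    (c₀ c₁ c₂ : ℝ) :
    ∫ s in a..c, s ^ r * (c₀ + c₁ * s + c₂ * s ^ 2) =
      c ^ (r + 1) * (c₀ / (r + 1) + c₁ * c / (r + 2) + c₂ * c ^ 2 / (r + 3)) -
        a ^ (r + 1) * (c₀ / (r + 1) + c₁ * a / (r + 2) + c₂ * a ^ 2 / (r + 3)) := by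
  refine intervalIntegral.integral_eq_sub_of_hasDerivAt_of_le (f := fun s : ℝ =>
    s ^ (r + 1) * (c₀ / (r + 1) + c₁ * s / (r + 2) + c₂ * s ^ 2 / (r + 3))) hac ?_ ?_
    (intervalIntegrable_rpow_mul_poly hr ..)
  · exact ((Real.continuous_rpow_const (by linarith)).mul (by fun_prop)).continuousOn
  · intro s hs
    have hs0 : 0 < s := ha.trans_lt hs.1
    have h1 := Real.hasDerivAt_rpow_const (x := s) (p := r + 1) (Or.inl hs0.ne')
    have h2 : HasDerivAt (fun s : ℝ => c₀ / (r + 1) + c₁ * s / (r + 2) + c₂ * s ^ 2 / (r + 3))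
        (c₁ / (r + 2) + c₂ * (2 * s) / (r + 3)) s := by
      have h3 := (((hasDerivAt_id s).const_mul c₁).div_const (r + 2)).const_add (c₀ / (r + 1))
      have h4 := (((hasDerivAt_id s).pow 2).const_mul c₂).div_const (r + 3)
      refine (h3.add h4).congr_deriv ?_
      simp
    refine (h1.mul h2).congr_deriv ?_
    have e1 : r + 1 ≠ 0 := by linarith
    have e2 : r + 2 ≠ 0 := by linarith
    have e3 : r + 3 ≠ 0 := by linarith
    rw [add_sub_cancel_right, Real.rpow_add_one hs0.ne']
    field_simp
    ring

section Triangle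

variable {r T : ℝ} {g : ℝ → ℝ → ℝ}

/-- The extension by zero of a weakly singular kernel on a triangle is integrable. -/
theorem integrable_indicator_triangle (hr : -1 < r)
    (hg : Continuous (Function.uncurry g)) :
    Integrable (Set.indicator {p : ℝ × ℝ | 0 < p.1 ∧ p.1 < p.2 ∧ p.2 ≤ T}
      fun p => (p.2 - p.1) ^ r * g p.1 p.2) (volume.prod volume) := by
  have hS : MeasurableSet {p : ℝ × ℝ | 0 < p.1 ∧ p.1 < p.2 ∧ p.2 ≤ T} :=
    (measurableSet_lt measurable_const measurable_fst).inter
      ((measurableSet_lt measurable_fst measurable_snd).inter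
        (measurableSet_le measurable_snd measurable_const))
  have h1 : Integrable (Set.indicator (Set.Ioc 0 T) fun _ : ℝ => (1 : ℝ)) :=
    (integrable_indicator_iff measurableSet_Ioc).2 (by simp)
  have h2 : Integrable (Set.indicator (Set.Ioc 0 T) fun s : ℝ => s ^ r) := by
    rw [integrable_indicator_iff measurableSet_Ioc]
    exact (intervalIntegral.intervalIntegrable_rpow' hr (a := 0) (b := T)).1
  have h3 := (h1.convolution_integrand (ContinuousLinearMap.mul ℝ ℝ) h2).swap
  obtain ⟨C, hC⟩ := ((isCompact_Icc (a := (0 : ℝ)) (b := T)).prod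
    (isCompact_Icc (a := (0 : ℝ)) (b := T))).exists_bound_of_continuousOn hg.continuousOn
  refine (h3.mul_const C).mono ?_ (ae_of_all _ fun p => ?_)
  · refine Measurable.aestronglyMeasurable (Measurable.indicator ?_ hS)
    exact ((measurable_snd.sub measurable_fst).pow_const r).mul hg.measurable
  · by_cases hp : p ∈ {p : ℝ × ℝ | 0 < p.1 ∧ p.1 < p.2 ∧ p.2 ≤ T}
    · obtain ⟨p1, p2, p3⟩ := id hp
      have hb := hC p ⟨⟨p1.le, by linarith⟩, ⟨by linarith, p3⟩⟩
      have m1 : p.1 ∈ Set.Ioc 0 T := ⟨p1, by linarith⟩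
      have m2 : p.2 - p.1 ∈ Set.Ioc 0 T := ⟨by linarith, by linarith⟩
      simp only [Function.comp, Prod.fst_swap, Prod.snd_swap, ContinuousLinearMap.mul_apply',
        Set.indicator_of_mem hp, Set.indicator_of_mem m1, Set.indicator_of_mem m2, one_mul,
        norm_mul]
      exact mul_le_mul_of_nonneg_left (hb.trans (le_abs_self C)) (norm_nonneg _)
    · rw [Set.indicator_of_notMem hp, norm_zero]
      exact norm_nonneg _

theorem integral_indicator_triangle_snd (f : ℝ → ℝ → ℝ) {u : ℝ} (hu : u ∈ Set.Ioc 0 T) :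
    ∫ v, Set.indicator {p : ℝ × ℝ | 0 < p.1 ∧ p.1 < p.2 ∧ p.2 ≤ T}
      (fun p => f p.1 p.2) (u, v) = ∫ v in u..T, f u v := by
  rw [intervalIntegral.integral_of_le hu.2, ← integral_indicator measurableSet_Ioc]
  congr 1 with v
  simp [Set.indicator, hu.1]

theorem integral_indicator_triangle_fst (f : ℝ → ℝ → ℝ) {v : ℝ} (hv : v ∈ Set.Ioc 0 T) :
    ∫ u, Set.indicator {p : ℝ × ℝ | 0 < p.1 ∧ p.1 < p.2 ∧ p.2 ≤ T}
      (fun p => f p.1 p.2) (u, v) = ∫ u in 0..v, f u v := by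
  rw [intervalIntegral.integral_of_le hv.1.le, integral_Ioc_eq_integral_Ioo,
    ← integral_indicator measurableSet_Ioo]
  congr 1 with u
  simp [Set.indicator, hv.2]

theorem integral_indicator_triangle_snd_eq_indicator (f : ℝ → ℝ → ℝ) :
    (fun u => ∫ v, Set.indicator {p : ℝ × ℝ | 0 < p.1 ∧ p.1 < p.2 ∧ p.2 ≤ T}
      (fun p => f p.1 p.2) (u, v)) =
      Set.indicator (Set.Ioc 0 T) fun u => ∫ v in u..T, f u v := by
  ext u
  by_cases hu : u ∈ Set.Ioc 0 T
  · rw [Set.indicator_of_mem hu, integral_indicator_triangle_snd f hu]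
  · rw [Set.indicator_of_notMem hu]
    refine integral_eq_zero_of_ae (ae_of_all _ fun v => Set.indicator_of_notMem ?_ _)
    rintro ⟨h1, h2, h3⟩
    exact hu ⟨h1, h2.le.trans h3⟩

theorem integral_indicator_triangle_fst_eq_indicator (f : ℝ → ℝ → ℝ) :
    (fun v => ∫ u, Set.indicator {p : ℝ × ℝ | 0 < p.1 ∧ p.1 < p.2 ∧ p.2 ≤ T}
      (fun p => f p.1 p.2) (u, v)) =
      Set.indicator (Set.Ioc 0 T) fun v => ∫ u in 0..v, f u v := by
  ext v
  by_cases hv : v ∈ Set.Ioc 0 T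
  · rw [Set.indicator_of_mem hv, integral_indicator_triangle_fst f hv]
  · rw [Set.indicator_of_notMem hv]
    refine integral_eq_zero_of_ae (ae_of_all _ fun u => Set.indicator_of_notMem ?_ _)
    rintro ⟨h1, h2, h3⟩
    exact hv ⟨h1.trans h2, h3⟩

theorem intervalIntegrable_integral_triangle (hT : 0 ≤ T) (hr : -1 < r)
    (hg : Continuous (Function.uncurry g)) :
    IntervalIntegrable (fun u => ∫ v in u..T, (v - u) ^ r * g u v) volume 0 T := by
  rw [intervalIntegrable_iff_integrableOn_Ioc_of_le hT,
    ← integrable_indicator_iff measurableSet_Ioc,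
    ← integral_indicator_triangle_snd_eq_indicator fun u v => (v - u) ^ r * g u v]
  exact (integrable_indicator_triangle hr hg).integral_prod_left

theorem integral_triangle_swap (hT : 0 ≤ T) (hr : -1 < r)
    (hg : Continuous (Function.uncurry g)) :
    ∫ u in 0..T, ∫ v in u..T, (v - u) ^ r * g u v =
      ∫ v in 0..T, ∫ u in 0..v, (v - u) ^ r * g u v := by
  rw [intervalIntegral.integral_of_le hT, intervalIntegral.integral_of_le hT,
    ← integral_indicator measurableSet_Ioc, ← integral_indicator measurableSet_Ioc,
    ← integral_indicator_triangle_snd_eq_indicator fun u v => (v - u) ^ r * g u v,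
    ← integral_indicator_triangle_fst_eq_indicator fun u v => (v - u) ^ r * g u v]
  exact integral_integral_swap (integrable_indicator_triangle hr hg)

end Triangle

theorem integral_integral_rpow_sub_mul {b T u v : ℝ} (hb : 0 < b) (hu : 0 ≤ u) (huv : u < v)
    (hv : v ≤ T) :
    ∫ u₂ in 0..u, ∫ v₂ in v..T, (v₂ - u₂) ^ (b - 1) * (T - v₂) =
      (T ^ (b + 2) - (T - u) ^ (b + 2) - v ^ (b + 2) + (v - u) ^ (b + 2)
        - (b + 2) * (T - v) * (v ^ (b + 1) - (v - u) ^ (b + 1))) / (b * (b + 1) * (b + 2)) := by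
  have hb0 : b ≠ 0 := hb.ne'
  have hb1 : b + 1 ≠ 0 := by positivity
  have hb2 : b + 2 ≠ 0 := by positivity
  have hinner : ∀ u₂ ∈ Set.uIcc 0 u, ∫ v₂ in v..T, (v₂ - u₂) ^ (b - 1) * (T - v₂) =
      (T - u₂) ^ b * (0 + 1 / (b * (b + 1)) * (T - u₂) + 0 * (T - u₂) ^ 2) -
        (v - u₂) ^ b * ((T - v) / b + 1 / (b * (b + 1)) * (v - u₂) + 0 * (v - u₂) ^ 2) := by
    intro u₂ h
    rw [Set.uIcc_of_le hu] at h
    have h1 := intervalIntegral.integral_comp_sub_right (a := v) (b := T)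
      (fun s : ℝ => s ^ (b - 1) * (T - u₂ + (-1) * s + 0 * s ^ 2)) u₂
    rw [integral_rpow_mul_poly (by linarith) (by linarith [h.2]) (by linarith)] at h1
    refine (Eq.trans ?_ h1).trans ?_
    · congr 1 with v₂
      ring
    · have e : b - 1 + 2 = b + 1 := by ring
      rw [sub_add_cancel, e]
      field_simp
      ring
  rw [intervalIntegral.integral_congr hinner, intervalIntegral.integral_sub,
    intervalIntegral.integral_comp_sub_left (fun s : ℝ =>
      s ^ b * (0 + 1 / (b * (b + 1)) * s + 0 * s ^ 2)),
    intervalIntegral.integral_comp_sub_left (fun s : ℝ =>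
      s ^ b * ((T - v) / b + 1 / (b * (b + 1)) * s + 0 * s ^ 2)),
    integral_rpow_mul_poly (by linarith) (by linarith) (by linarith),
    integral_rpow_mul_poly (by linarith) (by linarith) (by linarith)]
  · have h0 : ∀ x : ℝ, 0 < x → x ^ (b + 2) = x ^ (b + 1) * x := fun x hx => by
      rw [← Real.rpow_add_one hx.ne']; ring_nf
    rw [h0 T (by linarith), h0 (T - u) (by linarith), h0 v (by linarith), h0 (v - u) (by linarith),
      sub_zero, sub_zero]
    field_simp
    ring
  all_goals
    have hc : Continuous fun x : ℝ => x ^ b := Real.continuous_rpow_const hb.le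
    exact ((hc.comp (by fun_prop)).mul (by fun_prop)).intervalIntegrable _ _

theorem integral_integral_triangle_fst {b T : ℝ} (hb : 0 < b) (hT : 0 < T) :
    ∫ u in 0..T, ∫ v in u..T, (v - u) ^ (b - 1) * ((3 * T - u - 2 * v) *
      (-(T - u) ^ (b + 2) + (v - u) ^ (b + 2) + (b + 2) * (T - v) * (v - u) ^ (b + 1))) =
      T ^ (2 * b + 4) / (2 * b + 4) *
        (-(3 / b - 2 / (b + 1)) + 3 * (b + 2) / (2 * b + 1) + (3 - 5 * (b + 2)) / (2 * b + 2) +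
          (2 * (b + 2) - 2) / (2 * b + 3)) := by
  have hinner : ∀ u ∈ Set.Ioo 0 T, ∫ v in u..T, (v - u) ^ (b - 1) * ((3 * T - u - 2 * v) *
      (-(T - u) ^ (b + 2) + (v - u) ^ (b + 2) + (b + 2) * (T - v) * (v - u) ^ (b + 1))) =
      (T - u) ^ (2 * b + 3) *
        ((-(3 / b - 2 / (b + 1)) + 3 * (b + 2) / (2 * b + 1) + (3 - 5 * (b + 2)) / (2 * b + 2) +
          (2 * (b + 2) - 2) / (2 * b + 3)) + 0 * (T - u) + 0 * (T - u) ^ 2) := by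
    intro u hu
    have hx : 0 < T - u := sub_pos.2 hu.2
    set x := T - u with hxdef
    have hint (r c₀ c₁ c₂ : ℝ) (hr : -1 < r) := intervalIntegrable_rpow_mul_poly hr 0 x c₀ c₁ c₂
    calc _ = ∫ v in u..T, (fun s : ℝ =>
          s ^ (b - 1) * (-(3 * x * x ^ (b + 2)) + 2 * x ^ (b + 2) * s + 0 * s ^ 2) +
          s ^ (2 * b) * (3 * (b + 2) * x ^ 2 + (3 - 5 * (b + 2)) * x * s +
            (2 * (b + 2) - 2) * s ^ 2)) (v - u) := by
          refine intervalIntegral.integral_congr_Ioo_of_le hu.2.le fun v hv => ?_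
          have hs : 0 < v - u := sub_pos.2 hv.1
          have e1 : (v - u) ^ (b + 2) = (v - u) ^ (b - 1) * (v - u) ^ 3 := by
            rw [← Real.rpow_add_natCast hs.ne']; push_cast; ring_nf
          have e2 : (v - u) ^ (b + 1) = (v - u) ^ (b - 1) * (v - u) ^ 2 := by
            rw [← Real.rpow_add_natCast hs.ne']; push_cast; ring_nf
          have e3 : (v - u) ^ (2 * b) = (v - u) ^ (b - 1) * (v - u) ^ (b - 1) * (v - u) ^ 2 := by
            rw [← Real.rpow_add hs, ← Real.rpow_add_natCast hs.ne']; push_cast; ring_nf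
          simp only [e1, e2, e3]
          rw [show T - v = x - (v - u) by rw [hxdef]; ring,
            show 3 * T - u - 2 * v = 3 * x - 2 * (v - u) by rw [hxdef]; ring]
          ring
      _ = _ := by
          beta_reduce
          rw [intervalIntegral.integral_comp_sub_right (fun s : ℝ =>
              s ^ (b - 1) * (_ + _ * s + _ * s ^ 2) + s ^ (2 * b) * (_ + _ * s + _ * s ^ 2)),
            sub_self, ← hxdef, intervalIntegral.integral_add (hint _ _ _ _ (by linarith))
              (hint _ _ _ _ (by linarith)),
            integral_rpow_mul_poly (by linarith) le_rfl hx.le,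
            integral_rpow_mul_poly (by linarith) le_rfl hx.le,
            Real.zero_rpow (by linarith), Real.zero_rpow (by linarith), sub_add_cancel,
            show b - 1 + 2 = b + 1 by ring]
          have e1 : x ^ (b + 2) = x ^ b * x ^ 2 := by
            rw [← Real.rpow_add_natCast hx.ne']; push_cast; ring_nf
          have e2 : x ^ (2 * b + 1) = x ^ b * x ^ b * x := by
            rw [← Real.rpow_add hx, ← Real.rpow_add_one hx.ne']; ring_nf
          have e3 : x ^ (2 * b + 3) = x ^ b * x ^ b * x ^ 3 := by
            rw [← Real.rpow_add hx, ← Real.rpow_add_natCast hx.ne']; push_cast; ring_nf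
          rw [e1, e2, e3]
          field_simp
          ring
  rw [intervalIntegral.integral_congr_Ioo_of_le hT.le hinner,
    intervalIntegral.integral_comp_sub_left (fun s : ℝ =>
      s ^ (2 * b + 3) * (_ + 0 * s + 0 * s ^ 2)), sub_self, sub_zero,
    integral_rpow_mul_poly (by linarith) le_rfl hT.le, Real.zero_rpow (by linarith),
    show 2 * b + 3 + 1 = 2 * b + 4 by ring]
  ring

theorem integral_integral_triangle_snd {b T : ℝ} (hb : 0 < b) (hT : 0 < T) :
    ∫ v in 0..T, ∫ u in 0..v, (v - u) ^ (b - 1) * ((3 * T - u - 2 * v) *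
      (T ^ (b + 2) - v ^ (b + 2) - (b + 2) * (T - v) * v ^ (b + 1))) =
      T ^ (2 * b + 4) * (3 / (b * (b + 1)) + (1 / (b + 1) - 3 / b) / (b + 2)
        - (3 * (b + 2) / b / (2 * b + 2)
          + ((b + 2) * (1 / (b + 1) - 3 / b) - 3 * (b + 1) / b) / (2 * b + 3)
          - (b + 1) * (1 / (b + 1) - 3 / b) / (2 * b + 4))) := by
  have hinner : ∀ v ∈ Set.Ioo 0 T, ∫ u in 0..v, (v - u) ^ (b - 1) * ((3 * T - u - 2 * v) *
      (T ^ (b + 2) - v ^ (b + 2) - (b + 2) * (T - v) * v ^ (b + 1))) =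
      v ^ b * (T ^ (b + 2) * (3 * T / b) + T ^ (b + 2) * (1 / (b + 1) - 3 / b) * v + 0 * v ^ 2) +
      v ^ (2 * b + 1) * (-(3 * (b + 2) / b * T ^ 2) +
        -(((b + 2) * (1 / (b + 1) - 3 / b) - 3 * (b + 1) / b) * T) * v +
          (b + 1) * (1 / (b + 1) - 3 / b) * v ^ 2) := by
    intro v hv
    have hv0 : 0 < v := hv.1
    set D := T ^ (b + 2) - v ^ (b + 2) - (b + 2) * (T - v) * v ^ (b + 1) with hD
    have h1 := intervalIntegral.integral_comp_sub_left (a := 0) (b := v)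
      (fun s : ℝ => s ^ (b - 1) * (3 * (T - v) * D + D * s + 0 * s ^ 2)) v
    rw [sub_self, sub_zero, integral_rpow_mul_poly (by linarith) le_rfl hv0.le, sub_add_cancel,
      Real.zero_rpow hb.ne', show b - 1 + 2 = b + 1 by ring] at h1
    refine (Eq.trans ?_ h1).trans ?_
    · congr 1 with u
      ring
    · have e1 : v ^ (b + 2) = v ^ b * v ^ 2 := by
        rw [← Real.rpow_add_natCast hv0.ne']; push_cast; ring_nf
      have e2 : v ^ (b + 1) = v ^ b * v := Real.rpow_add_one hv0.ne' b
      have e3 : v ^ (2 * b + 1) = v ^ b * v ^ b * v := by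
        rw [← Real.rpow_add hv0, ← Real.rpow_add_one hv0.ne']; ring_nf
      rw [hD, e1, e2, e3]
      field_simp
      ring
  have hint (r c₀ c₁ c₂ : ℝ) (hr : -1 < r) := intervalIntegrable_rpow_mul_poly hr 0 T c₀ c₁ c₂
  rw [intervalIntegral.integral_congr_Ioo_of_le hT.le hinner,
    intervalIntegral.integral_add (hint _ _ _ _ (by linarith)) (hint _ _ _ _ (by linarith)),
    integral_rpow_mul_poly (by linarith) le_rfl hT.le,
    integral_rpow_mul_poly (by linarith) le_rfl hT.le,
    Real.zero_rpow (by linarith), Real.zero_rpow (by linarith)]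
  have e1 : T ^ (b + 2) = T ^ b * T ^ 2 := by
    rw [← Real.rpow_add_natCast hT.ne']; push_cast; ring_nf
  have e2 : T ^ (b + 1) = T ^ b * T := Real.rpow_add_one hT.ne' b
  have e3 : T ^ (2 * b + 1 + 1) = T ^ b * T ^ b * T ^ 2 := by
    rw [← Real.rpow_add hT, ← Real.rpow_add_natCast hT.ne']; push_cast; ring_nf
  have e4 : T ^ (2 * b + 4) = T ^ b * T ^ b * T ^ 4 := by
    rw [← Real.rpow_add hT, ← Real.rpow_add_natCast hT.ne']; push_cast; ring_nf
  rw [e1, e2, e3, e4, show 2 * b + 1 + 1 = 2 * b + 2 by ring,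
    show 2 * b + 1 + 2 = 2 * b + 3 by ring, show 2 * b + 1 + 3 = 2 * b + 4 by ring]
  field_simp
  ring

/-- For `1/2 < H < 1` and `T > 0`, the iterated integral over
the simplex `{0 ≤ u₂ ≤ u₁ ≤ v₁ ≤ v₂ ≤ T}` of
`4(H(2H-1))² (v₁-u₁)^(2H-2)(v₂-u₂)^(2H-2) [(T-u₁)(T-v₂) + 2(T-v₁)(T-v₂)]`
equals `((2H-1)(H+2)/((2H+1)(4H+2)(4H-1))) T^(4H+2)`. -/
theorem integral_simplex_I1 (H T : ℝ) (hH : 1 / 2 < H) (hH1 : H < 1) (hT : 0 < T) :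
    (∫ u₁ in (0 : ℝ)..T, ∫ v₁ in u₁..T, ∫ u₂ in (0 : ℝ)..u₁, ∫ v₂ in v₁..T,
        4 * (H * (2 * H - 1)) ^ 2 * (v₁ - u₁) ^ (2 * H - 2) * (v₂ - u₂) ^ (2 * H - 2) *
          ((T - u₁) * (T - v₂) + 2 * (T - v₁) * (T - v₂)))
      = (2 * H - 1) * (H + 2) / ((2 * H + 1) * (4 * H + 2) * (4 * H - 1)) * T ^ (4 * H + 2) := by
  obtain ⟨b, hb, rfl⟩ : ∃ b : ℝ, 0 < b ∧ H = (b + 1) / 2 := ⟨2 * H - 1, by linarith, by ring⟩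
  have c1 : 2 * ((b + 1) / 2) - 2 = b - 1 := by ring
  have c2 : 4 * ((b + 1) / 2) + 2 = 2 * b + 4 := by ring
  rw [c1, c2]
  have hc1 : Continuous fun x : ℝ => x ^ (b + 1) := Real.continuous_rpow_const (by linarith)
  have hc2 : Continuous fun x : ℝ => x ^ (b + 2) := Real.continuous_rpow_const (by linarith)
  set g₁ : ℝ → ℝ → ℝ := fun u v => (3 * T - u - 2 * v) *
    (-(T - u) ^ (b + 2) + (v - u) ^ (b + 2) + (b + 2) * (T - v) * (v - u) ^ (b + 1)) with hg₁
  set g₂ : ℝ → ℝ → ℝ := fun u v => (3 * T - u - 2 * v) *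
    (T ^ (b + 2) - v ^ (b + 2) - (b + 2) * (T - v) * v ^ (b + 1)) with hg₂
  have hg₁c : Continuous (Function.uncurry g₁) := by
    have h₁ : Continuous fun p : ℝ × ℝ => T - p.1 := by fun_prop
    have h₂ : Continuous fun p : ℝ × ℝ => p.2 - p.1 := by fun_prop
    refine Continuous.mul (by fun_prop) (((hc2.comp h₁).neg.add (hc2.comp h₂)).add
      (Continuous.mul ?_ (hc1.comp h₂)))
    fun_prop
  have hg₂c : Continuous (Function.uncurry g₂) := by
    refine Continuous.mul (by fun_prop) ((continuous_const.sub (hc2.comp continuous_snd)).sub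
      (Continuous.mul ?_ (hc1.comp continuous_snd)))
    fun_prop
  have hr : -1 < b - 1 := by linarith
  have hslice {g : ℝ → ℝ → ℝ} (hg : Continuous (Function.uncurry g)) (u : ℝ) :
      IntervalIntegrable (fun v => (v - u) ^ (b - 1) * g u v) volume u T := by
    have h := (intervalIntegral.intervalIntegrable_rpow' hr (a := 0) (b := T - u)).comp_sub_right u
    rw [zero_add, sub_add_cancel] at h
    exact h.mul_continuousOn (hg.comp (by fun_prop : Continuous fun v => (u, v))).continuousOn
  have hinner : ∀ u ∈ Set.Ioo 0 T, (∫ v in u..T, ∫ u₂ in (0 : ℝ)..u, ∫ v₂ in v..T,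
        4 * ((b + 1) / 2 * (2 * ((b + 1) / 2) - 1)) ^ 2 * (v - u) ^ (b - 1) *
          (v₂ - u₂) ^ (b - 1) * ((T - u) * (T - v₂) + 2 * (T - v) * (T - v₂))) =
      b * (b + 1) / (b + 2) * ((∫ v in u..T, (v - u) ^ (b - 1) * g₁ u v) +
        ∫ v in u..T, (v - u) ^ (b - 1) * g₂ u v) := by
    intro u hu
    rw [← intervalIntegral.integral_add (hslice hg₁c u) (hslice hg₂c u),
      ← intervalIntegral.integral_const_mul]
    refine intervalIntegral.integral_congr_Ioo_of_le hu.2.le fun v hv => ?_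
    calc _ = ∫ u₂ in (0 : ℝ)..u, ∫ v₂ in v..T, (4 * ((b + 1) / 2 * b) ^ 2 * (v - u) ^ (b - 1) *
          (3 * T - u - 2 * v)) * ((v₂ - u₂) ^ (b - 1) * (T - v₂)) := by
          congr 1 with u₂
          congr 1 with v₂
          ring
      _ = _ := by
          simp only [intervalIntegral.integral_const_mul]
          rw [integral_integral_rpow_sub_mul hb hu.1.le hv.1 hv.2.le, hg₁, hg₂]
          field_simp
          ring
  rw [intervalIntegral.integral_congr_Ioo_of_le hT.le hinner,
    intervalIntegral.integral_const_mul, intervalIntegral.integral_add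
      (intervalIntegrable_integral_triangle hT.le hr hg₁c)
      (intervalIntegrable_integral_triangle hT.le hr hg₂c),
    integral_triangle_swap hT.le hr hg₂c, hg₁, hg₂, integral_integral_triangle_fst hb hT,
    integral_integral_triangle_snd hb hT]
  have hb4 : 4 * ((b + 1) / 2) - 1 = 2 * b + 1 := by ring
  rw [hb4]
  field_simp
  ring
end

section
/- Let 1/2 < H < 1 and T > 0. Define G(u₁,v₁,u₂,v₂) := 4[ (T−max(u₁,v₂))(T−max(u₂,v₁)) + (T−max(u₁,u₂))(T−max(v₁,v₂)) + (T−max(u₁,v₁))(T−max(u₂,v₂)) ]. Then (1/4) ∫₀^T ∫₀^T ∫₀^T ∫_{v₁}^{T} G(u₁,v₁,u₂,v₂) φ_H(u₁,v₁) φ_H(u₂,v₂) dv₂ du₂ dv₁ du₁ = ( (8H²+18H+5) / (4(2H+1)²(4H+1)) − ℬ(2H+1, 2H+2)/(2H+1) ) · T^{4H+2}, where u₁, v₁, u₂ range over [0,T] and v₂ ranges over [v₁, T]. -/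
/-- The Beta function `ℬ(x,y) = ∫₀¹ t^(x-1) (1-t)^(y-1) dt`. -/
noncomputable def betaFn (x y : ℝ) : ℝ :=
  ∫ t in (0 : ℝ)..1, t ^ (x - 1) * (1 - t) ^ (y - 1)

open MeasureTheory Set intervalIntegral

lemma intervalIntegrable_max_rpow {r : ℝ} (hr : -1 < r) (h0 : r ≠ 0) (a b : ℝ) :
    IntervalIntegrable (fun t : ℝ => (max t 0) ^ r) volume a b := by
  have key : ∀ b : ℝ, IntervalIntegrable (fun t : ℝ => (max t 0) ^ r) volume 0 b := by
    intro b
    rcases le_total 0 b with hb | hb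
    · refine (intervalIntegrable_rpow' (a := 0) (b := b) hr).congr ?_
      intro t ht
      rw [uIoc_of_le hb] at ht
      simp [max_eq_left ht.1.le]
    · refine (IntervalIntegrable.zero (μ := volume) (a := 0) (b := b)).congr ?_
      intro t ht
      rw [uIoc_of_ge hb] at ht
      simp [max_eq_right ht.2, Real.zero_rpow h0]
  exact (key a).symm.trans (key b)

lemma integral_max_rpow {r : ℝ} (hr : -1 < r) (h0 : r ≠ 0) (a b : ℝ) :
    ∫ t in a..b, (max t 0) ^ r = ((max b 0) ^ (r + 1) - (max a 0) ^ (r + 1)) / (r + 1) := by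
  have key : ∀ b : ℝ, ∫ t in (0 : ℝ)..b, (max t 0) ^ r = (max b 0) ^ (r + 1) / (r + 1) := by
    intro b
    rcases le_total 0 b with hb | hb
    · rw [integral_congr (g := fun t => t ^ r), integral_rpow (Or.inl hr), max_eq_left hb,
        Real.zero_rpow (by linarith), sub_zero]
      intro t ht
      rw [uIcc_of_le hb] at ht
      simp [max_eq_left ht.1]
    · rw [integral_congr (g := fun _ => (0 : ℝ)), max_eq_right hb,
        Real.zero_rpow (by linarith)]
      · simp
      intro t ht
      rw [uIcc_of_ge hb] at ht
      simp [max_eq_right ht.2, Real.zero_rpow h0]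
  rw [← integral_interval_sub_left (intervalIntegrable_max_rpow hr h0 0 b)
    (intervalIntegrable_max_rpow hr h0 0 a), key, key, sub_div]

lemma abs_rpow_eq_add_max {r : ℝ} (h0 : r ≠ 0) (t : ℝ) :
    |t| ^ r = (max t 0) ^ r + (max (-t) 0) ^ r := by
  rcases le_total 0 t with h | h
  · rw [abs_of_nonneg h, max_eq_left h, max_eq_right (by linarith), Real.zero_rpow h0, add_zero]
  · rw [abs_of_nonpos h, max_eq_right h, max_eq_left (by linarith), Real.zero_rpow h0, zero_add]

lemma intervalIntegrable_abs_sub_rpow {r : ℝ} (hr : -1 < r) (h0 : r ≠ 0) (u a b : ℝ) :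
    IntervalIntegrable (fun v : ℝ => |u - v| ^ r) volume a b := by
  simp_rw [abs_rpow_eq_add_max h0, neg_sub]
  refine IntervalIntegrable.add ?_ ?_
  · simpa using (intervalIntegrable_max_rpow hr h0 (u - a) (u - b)).comp_sub_left u
  · simpa using (intervalIntegrable_max_rpow hr h0 (a - u) (b - u)).comp_sub_right u

lemma integral_abs_sub_rpow {r : ℝ} (hr : -1 < r) (h0 : r ≠ 0) (u y : ℝ) :
    ∫ v in (0 : ℝ)..y, |u - v| ^ r = ((max u 0) ^ (r + 1) - (max (u - y) 0) ^ (r + 1)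
      + (max (y - u) 0) ^ (r + 1) - (max (-u) 0) ^ (r + 1)) / (r + 1) := by
  simp_rw [abs_rpow_eq_add_max h0, neg_sub]
  rw [intervalIntegral.integral_add, integral_comp_sub_left (fun t => (max t 0) ^ r),
    integral_comp_sub_right (fun t => (max t 0) ^ r), integral_max_rpow hr h0,
    integral_max_rpow hr h0]
  · simp only [sub_zero, zero_sub]; ring
  · simpa using (intervalIntegrable_max_rpow hr h0 (u - 0) (u - y)).comp_sub_left u
  · simpa using (intervalIntegrable_max_rpow hr h0 (0 - u) (y - u)).comp_sub_right u

lemma integral_abs_sub_rpow_of_mem {r T x : ℝ} (hr : -1 < r) (h0 : r ≠ 0) (hx : 0 ≤ x)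
    (hxT : x ≤ T) :
    ∫ v in (0 : ℝ)..T, |x - v| ^ r = (x ^ (r + 1) + (T - x) ^ (r + 1)) / (r + 1) := by
  rw [integral_abs_sub_rpow hr h0, max_eq_left hx, max_eq_right (by linarith),
    max_eq_left (by linarith), max_eq_right (by linarith), Real.zero_rpow (by linarith)]
  ring

lemma integral_integral_abs_sub_rpow {r x y : ℝ} (hr : -1 < r) (h0 : r ≠ 0) (hx : 0 ≤ x)
    (hy : 0 ≤ y) :
    ∫ u in (0 : ℝ)..x, ∫ v in (0 : ℝ)..y, |u - v| ^ r
      = (x ^ (r + 2) + y ^ (r + 2) - |x - y| ^ (r + 2)) / ((r + 1) * (r + 2)) := by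
  have h1 : -1 < r + 1 := by linarith
  have h2 : r + 1 ≠ 0 := by linarith
  have hI := intervalIntegrable_max_rpow h1 h2
  have i1 : IntervalIntegrable (fun u : ℝ => (max u 0) ^ (r + 1)) volume 0 x := hI 0 x
  have i2 : IntervalIntegrable (fun u : ℝ => (max (u - y) 0) ^ (r + 1)) volume 0 x := by
    simpa using (hI (0 - y) (x - y)).comp_sub_right y
  have i3 : IntervalIntegrable (fun u : ℝ => (max (y - u) 0) ^ (r + 1)) volume 0 x := by
    simpa using (hI (y - 0) (y - x)).comp_sub_left y
  have i4 : IntervalIntegrable (fun u : ℝ => (max (-u) 0) ^ (r + 1)) volume 0 x := by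
    simpa using (hI (0 - 0) (0 - x)).comp_sub_left 0
  simp_rw [integral_abs_sub_rpow hr h0]
  rw [intervalIntegral.integral_div, integral_sub ((i1.sub i2).add i3) i4,
    integral_add (i1.sub i2) i3, integral_sub i1 i2,
    integral_comp_sub_right (fun t => (max t 0) ^ (r + 1)),
    integral_comp_sub_left (fun t => (max t 0) ^ (r + 1)),
    integral_comp_neg (fun t => (max t 0) ^ (r + 1))]
  simp_rw [integral_max_rpow h1 h2]
  have e : r + 1 + 1 = r + 2 := by ring
  have z : (0 : ℝ) ^ (r + 2) = 0 := Real.zero_rpow (by linarith)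
  rw [e, abs_rpow_eq_add_max (by linarith)]
  simp only [max_eq_left hx, max_eq_left hy, max_self, z, zero_sub, sub_zero, neg_zero, neg_sub,
    max_eq_right (neg_nonpos.2 hx), max_eq_right (neg_nonpos.2 hy)]
  have : r + 2 ≠ 0 := by linarith
  field_simp
  ring

lemma measurable_abs_sub_rpow (r : ℝ) : Measurable fun p : ℝ × ℝ => |p.1 - p.2| ^ r := by
  fun_prop

lemma integrable_abs_sub_rpow {r : ℝ} (hr : -1 < r) (h0 : r ≠ 0) {T : ℝ} (hT : 0 ≤ T) :
    Integrable (fun p : ℝ × ℝ => |p.1 - p.2| ^ r)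
      ((volume.restrict (Ioc 0 T)).prod (volume.restrict (Ioc 0 T))) := by
  rw [integrable_prod_iff (measurable_abs_sub_rpow r).aestronglyMeasurable]
  constructor
  · refine Filter.Eventually.of_forall fun u => ?_
    exact (intervalIntegrable_iff_integrableOn_Ioc_of_le hT).1
      (intervalIntegrable_abs_sub_rpow hr h0 u 0 T)
  · have : (fun u : ℝ => ∫ v, ‖|u - v| ^ r‖ ∂(volume.restrict (Ioc 0 T))) = fun u =>
        ((max u 0) ^ (r + 1) - (max (u - T) 0) ^ (r + 1)
      + (max (T - u) 0) ^ (r + 1) - (max (-u) 0) ^ (r + 1)) / (r + 1) := by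
      funext u
      rw [← integral_abs_sub_rpow hr h0, integral_of_le hT]
      refine integral_congr_ae (Filter.Eventually.of_forall fun v => ?_)
      exact Real.norm_of_nonneg (by positivity)
    simp only [this]
    have h1 : 0 ≤ r + 1 := by linarith
    have hc : Continuous fun u : ℝ => ((max u 0) ^ (r + 1) - (max (u - T) 0) ^ (r + 1)
      + (max (T - u) 0) ^ (r + 1) - (max (-u) 0) ^ (r + 1)) / (r + 1) := by
      have hm : Continuous fun u : ℝ => (max u 0) ^ (r + 1) :=
        (continuous_id.max continuous_const).rpow_const fun _ => Or.inr h1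
      exact (((hm.sub (hm.comp (continuous_id.sub continuous_const))).add
        (hm.comp (continuous_const.sub continuous_id))).sub (hm.comp continuous_neg)).div_const _
    exact (intervalIntegrable_iff_integrableOn_Ioc_of_le hT).1 (hc.intervalIntegrable 0 T)

/-- The indicator of `a ≤ x`. -/
noncomputable def stepLE (a x : ℝ) : ℝ := if a ≤ x then 1 else 0

lemma measurable_stepLE {α : Type*} [MeasurableSpace α] {f g : α → ℝ} (hf : Measurable f)
    (hg : Measurable g) : Measurable fun x => stepLE (f x) (g x) :=
  Measurable.ite (measurableSet_le hf hg) measurable_const measurable_const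

lemma norm_stepLE_le (a x : ℝ) : ‖stepLE a x‖ ≤ 1 := by
  unfold stepLE; split_ifs <;> simp

lemma integral_stepLE_mul_stepLE {T a b : ℝ} (ha : a ∈ Ioc 0 T) (hb : b ∈ Ioc 0 T) :
    ∫ x, stepLE a x * stepLE b x ∂(volume.restrict (Ioc 0 T)) = T - max a b := by
  have h : (fun x => stepLE a x * stepLE b x) = (Ici (max a b)).indicator fun _ => (1 : ℝ) := by
    funext x
    by_cases h1 : a ≤ x <;> by_cases h2 : b ≤ x <;> simp [stepLE, indicator, h1, h2]
  have hs : Ioc 0 T ∩ Ici (max a b) = Icc (max a b) T := by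
    ext x
    have : 0 < max a b := lt_max_of_lt_left ha.1
    simp only [mem_inter_iff, mem_Ioc, mem_Ici, mem_Icc]
    constructor
    · rintro ⟨⟨_, h1⟩, h2⟩; exact ⟨h2, h1⟩
    · rintro ⟨h1, h2⟩; exact ⟨⟨this.trans_le h1, h2⟩, h1⟩
  rw [h, setIntegral_indicator measurableSet_Ici, hs]
  simp [max_le ha.2 hb.2]

lemma integral_stepLE_mul {T y : ℝ} (hy : y ∈ Ioc 0 T) (g : ℝ → ℝ) :
    ∫ v, stepLE v y * g v ∂(volume.restrict (Ioc 0 T)) = ∫ v in (0 : ℝ)..y, g v := by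
  have h : (fun v => stepLE v y * g v) = (Iic y).indicator g := by
    funext x
    by_cases h1 : x ≤ y <;> simp [stepLE, indicator, h1]
  have hs : Ioc 0 T ∩ Iic y = Ioc 0 y := by
    rw [Ioc_inter_Iic, min_eq_right hy.2]
  rw [h, setIntegral_indicator measurableSet_Iic, hs, integral_of_le hy.1.le]

lemma ae_mem_box (T : ℝ) :
    ∀ᵐ p ∂((volume.restrict (Ioc 0 T)).prod (volume.restrict (Ioc 0 T))),
      p.1 ∈ Ioc 0 T ∧ p.2 ∈ Ioc 0 T := by
  rw [Measure.prod_restrict]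
  filter_upwards [ae_restrict_mem (measurableSet_Ioc.prod measurableSet_Ioc)] with p hp
  exact hp

lemma ae_mem_box_prod (T : ℝ) {ν : Measure (ℝ × ℝ)}
    (hν : ν = (volume.restrict (Ioc 0 T)).prod (volume.restrict (Ioc 0 T))) :
    ∀ᵐ w ∂(ν.prod ν), (w.1.1 ∈ Ioc 0 T ∧ w.1.2 ∈ Ioc 0 T) ∧
      (w.2.1 ∈ Ioc 0 T ∧ w.2.2 ∈ Ioc 0 T) := by
  have : SFinite ν := by rw [hν]; infer_instance
  have h : ∀ᵐ p ∂ν, p.1 ∈ Ioc 0 T ∧ p.2 ∈ Ioc 0 T := by rw [hν]; exact ae_mem_box T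
  filter_upwards [Measure.quasiMeasurePreserving_fst.ae h,
    Measure.quasiMeasurePreserving_snd.ae h] with w h1 h2
  exact ⟨h1, h2⟩

/-- The mass `f` puts on the rectangle below and to the left of `z`. -/
lemma integral_stepLE_stepLE_mul {T : ℝ} {f : ℝ × ℝ → ℝ} (hfm : Measurable f)
    (hf : Integrable f ((volume.restrict (Ioc 0 T)).prod (volume.restrict (Ioc 0 T))))
    {x y : ℝ} (hx : x ∈ Ioc 0 T) (hy : y ∈ Ioc 0 T) :
    ∫ p, stepLE p.1 x * stepLE p.2 y * f p
        ∂((volume.restrict (Ioc 0 T)).prod (volume.restrict (Ioc 0 T)))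
      = ∫ u in (0 : ℝ)..x, ∫ v in (0 : ℝ)..y, f (u, v) := by
  have hm : Measurable fun p : ℝ × ℝ => stepLE p.1 x * stepLE p.2 y :=
    (measurable_stepLE measurable_fst measurable_const).mul
      (measurable_stepLE measurable_snd measurable_const)
  have hi : Integrable (fun p : ℝ × ℝ => stepLE p.1 x * stepLE p.2 y * f p)
      ((volume.restrict (Ioc 0 T)).prod (volume.restrict (Ioc 0 T))) := by
    refine hf.norm.mono' (hm.mul hfm).aestronglyMeasurable (Filter.Eventually.of_forall fun p => ?_)
    rw [norm_mul, norm_mul]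
    exact mul_le_of_le_one_left (norm_nonneg _)
      (mul_le_one₀ (norm_stepLE_le _ _) (norm_nonneg _) (norm_stepLE_le _ _))
  rw [integral_prod _ hi, ← integral_stepLE_mul hx]
  refine integral_congr_ae (Filter.Eventually.of_forall fun u => ?_)
  simp only [mul_assoc]
  rw [MeasureTheory.integral_const_mul, integral_stepLE_mul hy]

lemma integral_sub_max_mul {T : ℝ} {f : ℝ × ℝ → ℝ} (hfm : Measurable f)
    (hf : Integrable f ((volume.restrict (Ioc 0 T)).prod (volume.restrict (Ioc 0 T)))) :
    ∫ p, (T - max p.1 p.2) * f p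
        ∂((volume.restrict (Ioc 0 T)).prod (volume.restrict (Ioc 0 T)))
      = ∫ x in Ioc 0 T, ∫ u in (0 : ℝ)..x, ∫ v in (0 : ℝ)..x, f (u, v) := by
  set μ : Measure ℝ := volume.restrict (Ioc 0 T) with hμ
  have hm : Measurable fun w : (ℝ × ℝ) × ℝ => stepLE w.1.1 w.2 * stepLE w.1.2 w.2 :=
    (measurable_stepLE (by fun_prop) (by fun_prop)).mul
      (measurable_stepLE (by fun_prop) (by fun_prop))
  have hi : Integrable (fun w : (ℝ × ℝ) × ℝ => stepLE w.1.1 w.2 * stepLE w.1.2 w.2 * f w.1)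
      ((μ.prod μ).prod μ) := by
    refine (hf.comp_fst μ).norm.mono' (hm.mul (by fun_prop)).aestronglyMeasurable
      (Filter.Eventually.of_forall fun p => ?_)
    rw [norm_mul, norm_mul]
    exact mul_le_of_le_one_left (norm_nonneg _)
      (mul_le_one₀ (norm_stepLE_le _ _) (norm_nonneg _) (norm_stepLE_le _ _))
  have hswap := integral_integral_swap
    (f := fun (p : ℝ × ℝ) (x : ℝ) => stepLE p.1 x * stepLE p.2 x * f p) hi
  have h1 : ∫ p, (T - max p.1 p.2) * f p ∂(μ.prod μ)
      = ∫ p, ∫ x, stepLE p.1 x * stepLE p.2 x * f p ∂μ ∂(μ.prod μ) := by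
    refine integral_congr_ae ?_
    filter_upwards [ae_mem_box T] with p hp
    rw [MeasureTheory.integral_mul_const, integral_stepLE_mul_stepLE hp.1 hp.2]
  rw [h1, hswap]
  refine integral_congr_ae ?_
  filter_upwards [ae_restrict_mem measurableSet_Ioc] with x hx
  exact integral_stepLE_stepLE_mul hfm hf hx hx

lemma integral_sub_max_mul_sub_max_mul {T : ℝ} {f : ℝ × ℝ → ℝ} (hfm : Measurable f)
    {ν : Measure (ℝ × ℝ)} (hν : ν = (volume.restrict (Ioc 0 T)).prod (volume.restrict (Ioc 0 T)))
    (hf : Integrable f ν) :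
    ∫ w, ((T - max w.1.1 w.2.1) * (T - max w.1.2 w.2.2)) * (f w.1 * f w.2) ∂(ν.prod ν)
      = ∫ z, (∫ u in (0 : ℝ)..z.1, ∫ v in (0 : ℝ)..z.2, f (u, v)) ^ 2 ∂ν := by
  have : IsFiniteMeasure ν := by rw [hν]; infer_instance
  let k : (ℝ × ℝ) → (ℝ × ℝ) → ℝ := fun p z => stepLE p.1 z.1 * stepLE p.2 z.2 * f p
  have hk1 : ∀ p z, ‖k p z‖ ≤ ‖f p‖ := fun p z => by
    simp only [k]
    rw [norm_mul, norm_mul]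
    exact mul_le_of_le_one_left (norm_nonneg _)
      (mul_le_one₀ (norm_stepLE_le _ _) (norm_nonneg _) (norm_stepLE_le _ _))
  have hkm : Measurable fun w : (ℝ × ℝ) × (ℝ × ℝ) => k w.1 w.2 :=
    ((measurable_stepLE (by fun_prop) (by fun_prop)).mul
      (measurable_stepLE (by fun_prop) (by fun_prop))).mul (by fun_prop)
  have hi : Integrable (fun w : ((ℝ × ℝ) × (ℝ × ℝ)) × (ℝ × ℝ) => k w.1.1 w.2 * k w.1.2 w.2)
      ((ν.prod ν).prod ν) := by
    refine ((hf.mul_prod hf).comp_fst ν).norm.mono' ?_ (Filter.Eventually.of_forall fun w => ?_)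
    · exact ((hkm.comp (by fun_prop : Measurable fun w : ((ℝ × ℝ) × (ℝ × ℝ)) × (ℝ × ℝ) =>
        (w.1.1, w.2))).mul (hkm.comp (by fun_prop : Measurable
          fun w : ((ℝ × ℝ) × (ℝ × ℝ)) × (ℝ × ℝ) => (w.1.2, w.2)))).aestronglyMeasurable
    · rw [norm_mul (k _ _), norm_mul (f _)]
      exact mul_le_mul (hk1 _ _) (hk1 _ _) (norm_nonneg _) (norm_nonneg _)
  have hswap := integral_integral_swap
    (f := fun (w : (ℝ × ℝ) × (ℝ × ℝ)) (z : ℝ × ℝ) => k w.1 z * k w.2 z) hi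
  have h1 : ∫ w, ((T - max w.1.1 w.2.1) * (T - max w.1.2 w.2.2)) * (f w.1 * f w.2) ∂(ν.prod ν)
      = ∫ w, ∫ z, k w.1 z * k w.2 z ∂ν ∂(ν.prod ν) := by
    refine integral_congr_ae ?_
    filter_upwards [ae_mem_box_prod T hν] with w hw
    have e : ∀ z : ℝ × ℝ, k w.1 z * k w.2 z = (stepLE w.1.1 z.1 * stepLE w.2.1 z.1) *
        (stepLE w.1.2 z.2 * stepLE w.2.2 z.2) * (f w.1 * f w.2) := fun z => by
      simp only [k]; ring
    simp only [e]
    rw [MeasureTheory.integral_mul_const, hν,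
      integral_prod_mul (fun x => stepLE w.1.1 x * stepLE w.2.1 x)
        (fun x => stepLE w.1.2 x * stepLE w.2.2 x),
      integral_stepLE_mul_stepLE hw.1.1 hw.2.1, integral_stepLE_mul_stepLE hw.1.2 hw.2.2]
  rw [h1, hswap]
  refine integral_congr_ae ?_
  have hz : ∀ᵐ z ∂ν, z.1 ∈ Ioc 0 T ∧ z.2 ∈ Ioc 0 T := by rw [hν]; exact ae_mem_box T
  filter_upwards [hz] with z hz
  rw [integral_prod_mul (fun p => k p z) (fun p => k p z), ← sq]
  have := integral_stepLE_stepLE_mul hfm (hν ▸ hf) hz.1 hz.2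
  rw [← this, hν]

/-- Exchanging the two coordinates of the second point. -/
lemma integral_prod_swap_snd {ν : Measure (ℝ × ℝ)} {μ : Measure ℝ} [SFinite μ]
    (hν : ν = μ.prod μ) (g : (ℝ × ℝ) × (ℝ × ℝ) → ℝ) :
    ∫ w, g (w.1, w.2.swap) ∂(ν.prod ν) = ∫ w, g w ∂(ν.prod ν) := by
  subst hν
  have h : MeasurePreserving
      (MeasurableEquiv.prodCongr (MeasurableEquiv.refl (ℝ × ℝ)) (MeasurableEquiv.prodComm))
      ((μ.prod μ).prod (μ.prod μ)) ((μ.prod μ).prod (μ.prod μ)) :=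
    (MeasurePreserving.id (μ.prod μ)).prod Measure.measurePreserving_swap
  exact h.integral_comp' g

/-- An integrand symmetric under exchange of the two points integrates over the half
`{v₁ < v₂}` to half of its total integral. -/
lemma integral_half_eq {T : ℝ} {ν : Measure (ℝ × ℝ)}
    (hν : ν = (volume.restrict (Ioc 0 T)).prod (volume.restrict (Ioc 0 T)))
    {F : (ℝ × ℝ) × (ℝ × ℝ) → ℝ} (hF : Integrable F (ν.prod ν)) (hs : ∀ w, F w.swap = F w) :
    ∫ w, (if w.1.2 < w.2.2 then F w else 0) ∂(ν.prod ν) = (∫ w, F w ∂(ν.prod ν)) / 2 := by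
  have : SFinite ν := by rw [hν]; infer_instance
  have hm : MeasurableSet {w : (ℝ × ℝ) × (ℝ × ℝ) | w.1.2 < w.2.2} :=
    measurableSet_lt (by fun_prop) (by fun_prop)
  have hm' : MeasurableSet {w : (ℝ × ℝ) × (ℝ × ℝ) | w.2.2 < w.1.2} :=
    measurableSet_lt (by fun_prop) (by fun_prop)
  have e1 : ∫ w, (if w.2.2 < w.1.2 then F w else 0) ∂(ν.prod ν)
      = ∫ w, (if w.1.2 < w.2.2 then F w else 0) ∂(ν.prod ν) := by
    rw [← integral_prod_swap]
    simp [hs]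
  have i1 : Integrable (fun w : (ℝ × ℝ) × (ℝ × ℝ) => if w.1.2 < w.2.2 then F w else 0)
      (ν.prod ν) := hF.indicator hm
  have i2 : Integrable (fun w : (ℝ × ℝ) × (ℝ × ℝ) => if w.2.2 < w.1.2 then F w else 0)
      (ν.prod ν) := hF.indicator hm'
  have hne : ∀ᵐ w ∂(ν.prod ν), w.1.2 ≠ w.2.2 := by
    have hD : MeasurableSet {w : (ℝ × ℝ) × (ℝ × ℝ) | w.1.2 ≠ w.2.2} :=
      (measurableSet_eq_fun (by fun_prop) (by fun_prop)).compl
    refine (Measure.ae_prod_iff_ae_ae hD).2 (Filter.Eventually.of_forall fun p => ?_)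
    have h0 : ∀ᵐ v ∂(volume.restrict (Ioc 0 T)), p.2 ≠ v := by
      filter_upwards [Measure.ae_ne (volume.restrict (Ioc 0 T)) p.2] with v hv using hv.symm
    rw [hν]
    exact Measure.quasiMeasurePreserving_snd.ae h0
  have e2 : ∫ w, F w ∂(ν.prod ν) = ∫ w, ((if w.1.2 < w.2.2 then F w else 0)
      + (if w.2.2 < w.1.2 then F w else 0)) ∂(ν.prod ν) := by
    refine integral_congr_ae ?_
    filter_upwards [hne] with w hw
    rcases lt_or_gt_of_ne hw with h | h
    · simp [h, h.not_gt]
    · simp [h, h.not_gt]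
  rw [e2, MeasureTheory.integral_add i1 i2, e1]
  ring

lemma Continuous.integrable_box {g : ℝ × ℝ → ℝ} (hg : Continuous g) (T : ℝ) :
    Integrable g ((volume.restrict (Ioc 0 T)).prod (volume.restrict (Ioc 0 T))) := by
  rw [Measure.prod_restrict]
  exact (hg.continuousOn.integrableOn_compact (isCompact_Icc.prod isCompact_Icc)).mono_set
    (prod_mono Ioc_subset_Icc_self Ioc_subset_Icc_self)

lemma integral_box {g : ℝ × ℝ → ℝ} (hg : Continuous g) {T : ℝ} (hT : 0 ≤ T) :
    ∫ z, g z ∂((volume.restrict (Ioc 0 T)).prod (volume.restrict (Ioc 0 T)))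
      = ∫ x in (0 : ℝ)..T, ∫ y in (0 : ℝ)..T, g (x, y) := by
  rw [integral_prod _ (hg.integrable_box T), integral_of_le hT]
  simp_rw [integral_of_le hT]

lemma integral_rpow_mul_sub_rpow {T : ℝ} (hT : 0 < T) (a b : ℝ) :
    ∫ x in (0 : ℝ)..T, x ^ (a - 1) * (T - x) ^ (b - 1) = T ^ (a + b - 1) * betaFn a b := by
  have h := intervalIntegral.smul_integral_comp_mul_left (a := 0) (b := 1)
    (fun x : ℝ => x ^ (a - 1) * (T - x) ^ (b - 1)) T
  rw [mul_zero, mul_one] at h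
  rw [← h, betaFn, smul_eq_mul, ← intervalIntegral.integral_const_mul,
    ← intervalIntegral.integral_const_mul]
  refine integral_congr fun x hx => ?_
  rw [uIcc_of_le zero_le_one] at hx
  have e : T - T * x = T * (1 - x) := by ring
  have e2 : T ^ (a + b - 1) = T * (T ^ (a - 1) * T ^ (b - 1)) := by
    rw [← Real.rpow_add hT, mul_comm, ← Real.rpow_add_one hT.ne']
    congr 1; ring
  rw [e, Real.mul_rpow hT.le hx.1, Real.mul_rpow hT.le (by linarith [hx.2]), e2]
  ring

/-- `∫∫ (x^s + y^s - |x - y|^s)²` over the square `[0, T]²`. -/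
lemma integral_sq_rpow_add_rpow_sub {T s : ℝ} (hT : 0 < T) (hs : 0 < s) :
    ∫ z : ℝ × ℝ, (z.1 ^ s + z.2 ^ s - |z.1 - z.2| ^ s) ^ 2
        ∂((volume.restrict (Ioc 0 T)).prod (volume.restrict (Ioc 0 T)))
      = (2 / (2 * s + 1) + 2 / ((2 * s + 1) * (2 * s + 2)) + 2 / (s + 1) ^ 2
        - 4 * ((1 / (2 * s + 2) + betaFn (s + 1) (s + 2)) / (s + 1))) * T ^ (2 * s + 2) := by
  have hp : Continuous fun x : ℝ => x ^ s := continuous_id.rpow_const fun _ => Or.inr hs.le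
  have c1 : Continuous fun z : ℝ × ℝ => z.1 ^ s := hp.comp continuous_fst
  have c2 : Continuous fun z : ℝ × ℝ => z.2 ^ s := hp.comp continuous_snd
  have c3 : Continuous fun z : ℝ × ℝ => |z.1 - z.2| ^ s :=
    hp.comp (continuous_abs.comp (continuous_fst.sub continuous_snd))
  have c11 : Continuous fun z : ℝ × ℝ => z.1 ^ s * z.1 ^ s := c1.mul c1
  have c22 : Continuous fun z : ℝ × ℝ => z.2 ^ s * z.2 ^ s := c2.mul c2
  have c33 : Continuous fun z : ℝ × ℝ => |z.1 - z.2| ^ s * |z.1 - z.2| ^ s := c3.mul c3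
  have c12 : Continuous fun z : ℝ × ℝ => z.1 ^ s * z.2 ^ s := c1.mul c2
  have c13 : Continuous fun z : ℝ × ℝ => z.1 ^ s * |z.1 - z.2| ^ s := c1.mul c3
  have c23 : Continuous fun z : ℝ × ℝ => z.2 ^ s * |z.1 - z.2| ^ s := c2.mul c3
  set π := (volume.restrict (Ioc 0 T)).prod (volume.restrict (Ioc 0 T)) with hπ
  have pw : ∀ x : ℝ, 0 ≤ x → x ^ s * x ^ s = x ^ (2 * s) := fun x hx => by
    rw [← Real.rpow_add_of_nonneg hx hs.le hs.le]; ring_nf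
  have I0 : ∀ r : ℝ, 0 < r → ∫ x in (0 : ℝ)..T, x ^ r = T ^ (r + 1) / (r + 1) := fun r hr => by
    rw [integral_rpow (Or.inl (by linarith)), Real.zero_rpow (by linarith), sub_zero]
  have E1 : ∫ z : ℝ × ℝ, z.1 ^ s * z.1 ^ s ∂π = T ^ (2 * s + 2) / (2 * s + 1) := by
    rw [integral_box c11 hT.le]
    simp only [intervalIntegral.integral_const, smul_eq_mul, sub_zero]
    rw [intervalIntegral.integral_const_mul, integral_congr (g := fun x => x ^ (2 * s)),
      I0 _ (by linarith)]
    · rw [show 2 * s + 2 = 2 * s + 1 + 1 by ring, Real.rpow_add_one hT.ne' (2 * s + 1)]; ring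
    · intro x hx
      rw [uIcc_of_le hT.le] at hx
      exact pw x hx.1
  have E2 : ∫ z : ℝ × ℝ, z.2 ^ s * z.2 ^ s ∂π = T ^ (2 * s + 2) / (2 * s + 1) := by
    rw [← E1, hπ, ← integral_prod_swap]; rfl
  have E3 : ∫ z : ℝ × ℝ, |z.1 - z.2| ^ s * |z.1 - z.2| ^ s ∂π
      = 2 * T ^ (2 * s + 2) / ((2 * s + 1) * (2 * s + 2)) := by
    rw [integral_box c33 hT.le]
    simp only [pw _ (abs_nonneg _)]
    rw [integral_integral_abs_sub_rpow (by linarith) (by linarith) hT.le hT.le, sub_self, abs_zero,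
      Real.zero_rpow (by linarith)]
    ring
  have E4 : ∫ z : ℝ × ℝ, z.1 ^ s * z.2 ^ s ∂π = T ^ (2 * s + 2) / (s + 1) ^ 2 := by
    rw [integral_box c12 hT.le]
    simp only [intervalIntegral.integral_const_mul, intervalIntegral.integral_mul_const, I0 s hs]
    have e : T ^ (2 * s + 2) = T ^ (s + 1) * T ^ (s + 1) := by
      rw [← Real.rpow_add hT]; ring_nf
    rw [e, sq, div_mul_div_comm]
  have E5 : ∫ z : ℝ × ℝ, z.1 ^ s * |z.1 - z.2| ^ s ∂π
      = (1 / (2 * s + 2) + betaFn (s + 1) (s + 2)) / (s + 1) * T ^ (2 * s + 2) := by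
    rw [integral_box c13 hT.le]
    simp only [intervalIntegral.integral_const_mul]
    have hp' : Continuous fun x : ℝ => x ^ (s + 1) :=
      continuous_id.rpow_const fun _ => Or.inr (by linarith)
    have hc : Continuous fun x : ℝ => x ^ s * (T - x) ^ (s + 1) :=
      hp.mul (hp'.comp (continuous_const.sub continuous_id))
    have hc' : Continuous fun x : ℝ => x ^ (2 * s + 1) :=
      continuous_id.rpow_const fun _ => Or.inr (by linarith)
    rw [integral_congr (g := fun x => (x ^ (2 * s + 1) + x ^ s * (T - x) ^ (s + 1)) / (s + 1)),
      intervalIntegral.integral_div, intervalIntegral.integral_add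
        (hc'.intervalIntegrable _ _) (hc.intervalIntegrable _ _), I0 _ (by linarith)]
    · have hb := integral_rpow_mul_sub_rpow hT (s + 1) (s + 2)
      rw [show s + 1 - 1 = s by ring, show s + 2 - 1 = s + 1 by ring,
        show s + 1 + (s + 2) - 1 = 2 * s + 2 by ring] at hb
      rw [hb, show 2 * s + 1 + 1 = 2 * s + 2 by ring]
      ring
    · intro x hx
      rw [uIcc_of_le hT.le] at hx
      simp only
      rw [integral_abs_sub_rpow_of_mem (by linarith) hs.ne' hx.1 hx.2,
        show 2 * s + 1 = s + (s + 1) by ring,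
        Real.rpow_add_of_nonneg hx.1 hs.le (by linarith : 0 ≤ s + 1)]
      ring
  have E6 : ∫ z : ℝ × ℝ, z.2 ^ s * |z.1 - z.2| ^ s ∂π
      = (1 / (2 * s + 2) + betaFn (s + 1) (s + 2)) / (s + 1) * T ^ (2 * s + 2) := by
    rw [← E5, hπ, ← integral_prod_swap]
    simp only [Prod.fst_swap, Prod.snd_swap, abs_sub_comm]
  have hex : ∀ z : ℝ × ℝ, (z.1 ^ s + z.2 ^ s - |z.1 - z.2| ^ s) ^ 2
      = z.1 ^ s * z.1 ^ s + z.2 ^ s * z.2 ^ s + |z.1 - z.2| ^ s * |z.1 - z.2| ^ s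
        + 2 * (z.1 ^ s * z.2 ^ s) + -2 * (z.1 ^ s * |z.1 - z.2| ^ s)
        + -2 * (z.2 ^ s * |z.1 - z.2| ^ s) := fun z => by ring
  simp only [hex]
  have i11 := c11.integrable_box T
  have i22 := c22.integrable_box T
  have i33 := c33.integrable_box T
  have i12 := (c12.integrable_box T).const_mul 2
  have i13 := (c13.integrable_box T).const_mul (-2)
  have i23 := (c23.integrable_box T).const_mul (-2)
  rw [MeasureTheory.integral_add ((((i11.fun_add i22).fun_add i33).fun_add i12).fun_add i13) i23,
    MeasureTheory.integral_add (((i11.fun_add i22).fun_add i33).fun_add i12) i13,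
    MeasureTheory.integral_add ((i11.fun_add i22).fun_add i33) i12,
    MeasureTheory.integral_add (i11.fun_add i22) i33, MeasureTheory.integral_add i11 i22,
    MeasureTheory.integral_const_mul, MeasureTheory.integral_const_mul,
    MeasureTheory.integral_const_mul, E1, E2, E3, E4, E5, E6]
  ring

lemma integral_integral_half_box {T : ℝ} (hT : 0 ≤ T) {ν : Measure (ℝ × ℝ)}
    (hν : ν = (volume.restrict (Ioc 0 T)).prod (volume.restrict (Ioc 0 T)))
    {F : (ℝ × ℝ) × (ℝ × ℝ) → ℝ} (hF : Integrable F (ν.prod ν)) :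
    ∫ u₁ in (0 : ℝ)..T, ∫ v₁ in (0 : ℝ)..T, ∫ u₂ in (0 : ℝ)..T, ∫ v₂ in v₁..T,
        F ((u₁, v₁), (u₂, v₂))
      = ∫ w, (if w.1.2 < w.2.2 then F w else 0) ∂(ν.prod ν) := by
  subst hν
  have hm : MeasurableSet {w : (ℝ × ℝ) × (ℝ × ℝ) | w.1.2 < w.2.2} :=
    measurableSet_lt (by fun_prop) (by fun_prop)
  have hi : Integrable (fun w : (ℝ × ℝ) × (ℝ × ℝ) => if w.1.2 < w.2.2 then F w else 0) _ :=
    hF.indicator hm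
  rw [integral_prod _ hi, integral_prod _ hi.integral_prod_left, integral_of_le hT]
  refine integral_congr_ae ?_
  filter_upwards [Measure.ae_ae_of_ae_prod hi.prod_right_ae] with u₁ h₁
  rw [integral_of_le hT]
  refine integral_congr_ae ?_
  filter_upwards [h₁, ae_restrict_mem measurableSet_Ioc] with v₁ h₂ hv
  rw [integral_prod _ h₂, integral_of_le hT]
  refine integral_congr_ae (Filter.Eventually.of_forall fun u₂ => ?_)
  have hind : (fun v₂ => if v₁ < v₂ then F ((u₁, v₁), (u₂, v₂)) else 0)
      = (Ioi v₁).indicator fun v₂ => F ((u₁, v₁), (u₂, v₂)) := by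
    funext x
    simp [indicator]
  have hs : Ioc 0 T ∩ Ioi v₁ = Ioc v₁ T := by
    rw [Ioc_inter_Ioi, max_eq_right hv.1.le]
  simp only
  rw [hind, setIntegral_indicator measurableSet_Ioi, hs, integral_of_le hv.2]

lemma norm_sub_max_le {T a b : ℝ} (ha : a ∈ Ioc 0 T) (hb : b ∈ Ioc 0 T) :
    ‖T - max a b‖ ≤ T := by
  have h1 : 0 < max a b := lt_max_of_lt_left ha.1
  have h2 : max a b ≤ T := max_le ha.2 hb.2
  rw [Real.norm_of_nonneg (by linarith)]
  linarith

lemma integrable_mul_of_ae_norm_le {α : Type*} [MeasurableSpace α] {μ : Measure α} {f g : α → ℝ}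
    (hf : Integrable f μ) (hg : Measurable g) {C : ℝ} (hC : ∀ᵐ x ∂μ, ‖g x‖ ≤ C) :
    Integrable (fun x => g x * f x) μ := by
  refine (hf.norm.const_mul C).mono' (hg.aestronglyMeasurable.mul hf.1) ?_
  filter_upwards [hC] with x hx
  rw [norm_mul]
  exact mul_le_mul_of_nonneg_right hx (norm_nonneg _)

/-- The second-order integral of a symmetric kernel `f`, in terms of the masses of rectangles. -/
lemma integral_half_box_kernel {T : ℝ} (hT : 0 ≤ T) {f : ℝ × ℝ → ℝ} (hfm : Measurable f)
    {ν : Measure (ℝ × ℝ)} (hν : ν = (volume.restrict (Ioc 0 T)).prod (volume.restrict (Ioc 0 T)))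
    (hf : Integrable f ν) (hsymm : ∀ p, f p.swap = f p) :
    ∫ u₁ in (0 : ℝ)..T, ∫ v₁ in (0 : ℝ)..T, ∫ u₂ in (0 : ℝ)..T, ∫ v₂ in v₁..T,
        ((T - max u₁ v₂) * (T - max u₂ v₁) + (T - max u₁ u₂) * (T - max v₁ v₂)
          + (T - max u₁ v₁) * (T - max u₂ v₂)) * (f (u₁, v₁) * f (u₂, v₂))
      = ∫ z, (∫ u in (0 : ℝ)..z.1, ∫ v in (0 : ℝ)..z.2, f (u, v)) ^ 2 ∂ν
        + (∫ x in (0 : ℝ)..T, ∫ u in (0 : ℝ)..x, ∫ v in (0 : ℝ)..x, f (u, v)) ^ 2 / 2 := by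
  have : SFinite ν := by rw [hν]; infer_instance
  let A : (ℝ × ℝ) × (ℝ × ℝ) → ℝ := fun w =>
    ((T - max w.1.1 w.2.2) * (T - max w.2.1 w.1.2)) * (f w.1 * f w.2)
  let B : (ℝ × ℝ) × (ℝ × ℝ) → ℝ := fun w =>
    ((T - max w.1.1 w.2.1) * (T - max w.1.2 w.2.2)) * (f w.1 * f w.2)
  let C : (ℝ × ℝ) × (ℝ × ℝ) → ℝ := fun w =>
    ((T - max w.1.1 w.1.2) * (T - max w.2.1 w.2.2)) * (f w.1 * f w.2)
  have hff := hf.mul_prod hf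
  have hA : Integrable A (ν.prod ν) := by
    refine integrable_mul_of_ae_norm_le hff (by fun_prop) (C := T * T) ?_
    filter_upwards [ae_mem_box_prod T hν] with w hw
    rw [norm_mul]
    exact mul_le_mul (norm_sub_max_le hw.1.1 hw.2.2) (norm_sub_max_le hw.2.1 hw.1.2)
      (norm_nonneg _) hT
  have hB : Integrable B (ν.prod ν) := by
    refine integrable_mul_of_ae_norm_le hff (by fun_prop) (C := T * T) ?_
    filter_upwards [ae_mem_box_prod T hν] with w hw
    rw [norm_mul]
    exact mul_le_mul (norm_sub_max_le hw.1.1 hw.2.1) (norm_sub_max_le hw.1.2 hw.2.2)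
      (norm_nonneg _) hT
  have hC : Integrable C (ν.prod ν) := by
    refine integrable_mul_of_ae_norm_le hff (by fun_prop) (C := T * T) ?_
    filter_upwards [ae_mem_box_prod T hν] with w hw
    rw [norm_mul]
    exact mul_le_mul (norm_sub_max_le hw.1.1 hw.1.2) (norm_sub_max_le hw.2.1 hw.2.2)
      (norm_nonneg _) hT
  have hF : Integrable (fun w => A w + B w + C w) (ν.prod ν) := (hA.add hB).add hC
  have hIB := integral_sub_max_mul_sub_max_mul hfm hν hf
  have hIA : ∫ w, A w ∂(ν.prod ν) = ∫ w, B w ∂(ν.prod ν) := by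
    rw [← integral_prod_swap_snd hν B]
    refine integral_congr_ae (Filter.Eventually.of_forall fun w => ?_)
    simp only [A, B, Prod.fst_swap, Prod.snd_swap, hsymm, max_comm w.2.1 w.1.2]
  have hIC : ∫ w, C w ∂(ν.prod ν)
      = (∫ x in (0 : ℝ)..T, ∫ u in (0 : ℝ)..x, ∫ v in (0 : ℝ)..x, f (u, v)) ^ 2 := by
    rw [integral_of_le hT, ← integral_sub_max_mul hfm (hν ▸ hf), ← hν, sq, ← integral_prod_mul]
    refine integral_congr_ae (Filter.Eventually.of_forall fun w => ?_)
    simp only [C]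
    ring
  have hsF : ∀ w : (ℝ × ℝ) × (ℝ × ℝ), A w.swap + B w.swap + C w.swap = A w + B w + C w := by
    intro w
    simp only [A, B, C, Prod.fst_swap, Prod.snd_swap, max_comm w.2.1 w.1.1,
      max_comm w.2.2 w.1.2]
    ring
  have h1 := integral_integral_half_box hT hν hF
  have h2 := integral_half_eq hν hF hsF
  have h3 : ∫ w, (A w + B w + C w) ∂(ν.prod ν)
      = ∫ w, A w ∂(ν.prod ν) + ∫ w, B w ∂(ν.prod ν) + ∫ w, C w ∂(ν.prod ν) := by
    rw [MeasureTheory.integral_add (hA.fun_add hB) hC, MeasureTheory.integral_add hA hB]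
  rw [h2, h3, hIA, hIC] at h1
  rw [← hIB]
  simp only [A, B, C, ← add_mul] at h1
  rw [h1]
  ring

/-- For `1/2 < H < 1` and `T > 0`, with
`G(u₁,v₁,u₂,v₂) = 4[(T-max(u₁,v₂))(T-max(u₂,v₁)) + (T-max(u₁,u₂))(T-max(v₁,v₂))
+ (T-max(u₁,v₁))(T-max(u₂,v₂))]` and `φ_H(s,t) = H(2H-1)|s-t|^(2H-2)`,
`(1/4) ∫₀^T ∫₀^T ∫₀^T ∫_{v₁}^T G φ_H(u₁,v₁) φ_H(u₂,v₂) dv₂ du₂ dv₁ du₁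
  = ((8H²+18H+5)/(4(2H+1)²(4H+1)) - ℬ(2H+1,2H+2)/(2H+1)) T^(4H+2)`. -/
theorem integral_fcir_second_order (H T : ℝ) (hH : 1 / 2 < H) (hH1 : H < 1) (hT : 0 < T) :
    (1 / 4) * (∫ u₁ in (0 : ℝ)..T, ∫ v₁ in (0 : ℝ)..T, ∫ u₂ in (0 : ℝ)..T, ∫ v₂ in v₁..T,
        (4 * ((T - max u₁ v₂) * (T - max u₂ v₁) + (T - max u₁ u₂) * (T - max v₁ v₂)
            + (T - max u₁ v₁) * (T - max u₂ v₂))) *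
          (H * (2 * H - 1) * |u₁ - v₁| ^ (2 * H - 2)) *
          (H * (2 * H - 1) * |u₂ - v₂| ^ (2 * H - 2)))
      = ((8 * H ^ 2 + 18 * H + 5) / (4 * (2 * H + 1) ^ 2 * (4 * H + 1))
          - betaFn (2 * H + 1) (2 * H + 2) / (2 * H + 1)) * T ^ (4 * H + 2) := by

  set r : ℝ := 2 * H - 2 with hr
  have hr1 : -1 < r := by linarith
  have hr0 : r ≠ 0 := by linarith
  have hs : 0 < 2 * H := by linarith
  have hrs : r + 2 = 2 * H := by rw [hr]; ring
  have hk := integral_half_box_kernel hT.le (measurable_abs_sub_rpow r) rfl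
    (integrable_abs_sub_rpow hr1 hr0 hT.le) (fun p => by simp [abs_sub_comm])
  have hin : ∀ u₁ v₁ u₂ v₂ : ℝ,
      (4 * ((T - max u₁ v₂) * (T - max u₂ v₁) + (T - max u₁ u₂) * (T - max v₁ v₂)
            + (T - max u₁ v₁) * (T - max u₂ v₂))) *
          (H * (2 * H - 1) * |u₁ - v₁| ^ r) * (H * (2 * H - 1) * |u₂ - v₂| ^ r)
      = (4 * (H * (2 * H - 1)) ^ 2) * (((T - max u₁ v₂) * (T - max u₂ v₁)
          + (T - max u₁ u₂) * (T - max v₁ v₂) + (T - max u₁ v₁) * (T - max u₂ v₂)) *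
          (|u₁ - v₁| ^ r * |u₂ - v₂| ^ r)) := fun _ _ _ _ => by ring
  simp only [hin, intervalIntegral.integral_const_mul]
  rw [hk]
  have hcc : (r + 1) * (r + 2) = 2 * (H * (2 * H - 1)) := by rw [hr]; ring
  have hc0 : H * (2 * H - 1) ≠ 0 := (mul_pos (by linarith) (by linarith)).ne'
  have hsq : ∫ z : ℝ × ℝ, (∫ u in (0 : ℝ)..z.1, ∫ v in (0 : ℝ)..z.2, |u - v| ^ r) ^ 2
        ∂((volume.restrict (Ioc 0 T)).prod (volume.restrict (Ioc 0 T)))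
      = (1 / (2 * (H * (2 * H - 1))) ^ 2) *
        ∫ z : ℝ × ℝ, (z.1 ^ (2 * H) + z.2 ^ (2 * H) - |z.1 - z.2| ^ (2 * H)) ^ 2
        ∂((volume.restrict (Ioc 0 T)).prod (volume.restrict (Ioc 0 T))) := by
    rw [← MeasureTheory.integral_const_mul]
    refine integral_congr_ae ?_
    filter_upwards [ae_mem_box T] with z hz
    rw [integral_integral_abs_sub_rpow hr1 hr0 hz.1.1.le hz.2.1.le, hcc, hrs,
      div_pow, one_div_mul_eq_div]
  have hdiag : ∫ x in (0 : ℝ)..T, ∫ u in (0 : ℝ)..x, ∫ v in (0 : ℝ)..x, |u - v| ^ r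
      = T ^ (2 * H + 1) / (2 * H + 1) / (H * (2 * H - 1)) := by
    rw [integral_congr (g := fun x => x ^ (2 * H) / (H * (2 * H - 1))),
      intervalIntegral.integral_div, integral_rpow (Or.inl (by linarith)),
      Real.zero_rpow (by linarith), sub_zero]
    intro x hx
    rw [uIcc_of_le hT.le] at hx
    simp only
    rw [integral_integral_abs_sub_rpow hr1 hr0 hx.1 hx.1, hcc, hrs, sub_self, abs_zero,
      Real.zero_rpow hs.ne', sub_zero]
    field_simp
    ring
  rw [hsq, hdiag, integral_sq_rpow_add_rpow_sub hT hs]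
  have hT2 : T ^ (2 * (2 * H) + 2) = T ^ (2 * H + 1) * T ^ (2 * H + 1) := by
    rw [← Real.rpow_add hT]; ring_nf
  have hT4 : T ^ (4 * H + 2) = T ^ (2 * H + 1) * T ^ (2 * H + 1) := by
    rw [← Real.rpow_add hT]; ring_nf
  rw [hT2, hT4]
  generalize T ^ (2 * H + 1) = X
  generalize betaFn (2 * H + 1) (2 * H + 2) = b
  generalize H * (2 * H - 1) = c at hc0 ⊢
  have d1 : 2 * H + 1 ≠ 0 := by linarith
  have d2 : 4 * H + 1 ≠ 0 := by linarith
  rw [show 2 * (2 * H) + 1 = 4 * H + 1 by ring, show 2 * (2 * H) + 2 = 2 * (2 * H + 1) by ring]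
  field_simp
  ring
end
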